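/- Let P_{ALC-1} = (0, 1/(4m+2), 1/(4m+2), 0, (1/(4m+2))·√((4m+1)/(2m+2)), (1/(2m+1))·√((4m+1)/(2m+2))) and let f(p) = (√2/2)(2Y₂ − Y₃) + X₃ − X₂. There exists ε > 0 such that for every point p ∈ 𝓢 ∩ ∂𝓔 with ‖p − P_{ALC-1}‖ < ε and X₂(p) > X₃(p), the directional derivative of f along the Einstein vector field is strictly positive at p, i.e. ⟨∇f(p), V(p)⟩ > 0. -/

import Mathlib

open Real Set Filter

noncomputable section

/-- The quadratic form `G(p) = X₁² + 2X₂² + 4m X₃²`. -/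
def G (m : ℕ) (p : Fin 6 → ℝ) : ℝ := (p 0)^2 + 2*(p 1)^2 + 4*(m:ℝ)*(p 2)^2

/-- `R₁(p) = (1/2)Y₁²Y₂² + (m/4)Y₁²Y₃²`. -/
def R1 (m : ℕ) (p : Fin 6 → ℝ) : ℝ := (1/2)*(p 3)^2*(p 4)^2 + ((m:ℝ)/4)*(p 3)^2*(p 5)^2

/-- `R₂(p) = 2Y₂² − (1/2)Y₁²Y₂² + (m/2)Y₃²`. -/
def R2 (m : ℕ) (p : Fin 6 → ℝ) : ℝ := 2*(p 4)^2 - (1/2)*(p 3)^2*(p 4)^2 + ((m:ℝ)/2)*(p 5)^2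

/-- `R₃(p) = (m+2)Y₂Y₃ − (1/8)Y₁²Y₃² − (1/2)Y₃²`. -/
def R3 (m : ℕ) (p : Fin 6 → ℝ) : ℝ :=
  ((m:ℝ)+2)*(p 4)*(p 5) - (1/8)*(p 3)^2*(p 5)^2 - (1/2)*(p 5)^2

/-- `R_s = R₁ + 2R₂ + 4m R₃`. -/
def Rs (m : ℕ) (p : Fin 6 → ℝ) : ℝ := R1 m p + 2*R2 m p + 4*(m:ℝ)*R3 m p

/-- `L = (G + R_s − 1)/(4m+2)`. -/
def L (m : ℕ) (p : Fin 6 → ℝ) : ℝ := (G m p + Rs m p - 1)/(4*(m:ℝ)+2)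

/-- The Einstein vector field. -/
def V (m : ℕ) (p : Fin 6 → ℝ) : Fin 6 → ℝ :=
  ![ p 0 * (G m p + L m p - 1) + R1 m p - L m p,
     p 1 * (G m p + L m p - 1) + R2 m p - L m p,
     p 2 * (G m p + L m p - 1) + R3 m p - L m p,
     p 3 * (p 0 - p 1),
     p 4 * (G m p + L m p - p 1),
     p 5 * (G m p + L m p + p 1 - 2*p 2) ]

/-- `𝓔 = {p : X₁+2X₂+4m X₃ = 1 and G + R_s ≤ 1}`. -/
def setE (m : ℕ) : Set (Fin 6 → ℝ) :=
  {p | p 0 + 2*p 1 + 4*(m:ℝ)*p 2 = 1 ∧ G m p + Rs m p ≤ 1}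

/-- `∂𝓔 = {p : X₁+2X₂+4m X₃ = 1 and G + R_s = 1}`. -/
def bdryE (m : ℕ) : Set (Fin 6 → ℝ) :=
  {p | p 0 + 2*p 1 + 4*(m:ℝ)*p 2 = 1 ∧ G m p + Rs m p = 1}

/-- `𝓟 = {p : Y₁ ≥ 0, Y₂ ≥ 0, Y₃ ≥ 0}`. -/
def setP : Set (Fin 6 → ℝ) := {p | 0 ≤ p 3 ∧ 0 ≤ p 4 ∧ 0 ≤ p 5}

/-- `𝓐₁ = {p : X₁ ≤ X₂ and Y₁² ≤ 2}`. -/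
def setA1 : Set (Fin 6 → ℝ) := {p | p 0 ≤ p 1 ∧ (p 3)^2 ≤ 2}

/-- `𝓐₂`. -/
def setA2 : Set (Fin 6 → ℝ) :=
  {p | 0 ≤ 2*p 4 - p 5 ∧ 0 ≤ (Real.sqrt 2/2)*(2*p 4 - p 5) + p 2 - p 1 ∧
       p 1 ≤ 1/2 ∧ 0 ≤ p 2}

/-- The compact invariant set `𝓢`. -/
def setS (m : ℕ) : Set (Fin 6 → ℝ) := setE m ∩ setP ∩ setA1 ∩ setA2

/-- A solution of the Einstein ODE system on a set `I ⊆ ℝ`. -/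
def IsSolution (m : ℕ) (I : Set ℝ) (c : ℝ → Fin 6 → ℝ) : Prop :=
  ∀ η ∈ I, HasDerivWithinAt c (V m (c η)) I η

/-- The critical point `P_{ALC-1}`. -/
def PALC1 (m : ℕ) : Fin 6 → ℝ :=
  ![0, 1/(4*(m:ℝ)+2), 1/(4*(m:ℝ)+2), 0,
    (1/(4*(m:ℝ)+2)) * Real.sqrt ((4*(m:ℝ)+1)/(2*(m:ℝ)+2)),
    (1/(2*(m:ℝ)+1)) * Real.sqrt ((4*(m:ℝ)+1)/(2*(m:ℝ)+2))]

/-- The derivative of `(√2/2)(2Y₂ − Y₃) + X₃ − X₂` along an arbitrary vector. -/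
theorem fderiv_barrier_apply (p v : Fin 6 → ℝ) :
    fderiv ℝ (fun q : Fin 6 → ℝ => (Real.sqrt 2/2)*(2*q 4 - q 5) + q 2 - q 1) p v =
      (Real.sqrt 2/2)*(2*v 4 - v 5) + v 2 - v 1 := by
  have h (i : Fin 6) : HasFDerivAt (fun q : Fin 6 → ℝ => q i)
      (ContinuousLinearMap.proj (R := ℝ) (φ := fun _ : Fin 6 => ℝ) i) p := hasFDerivAt_apply i p
  have hf := (((((h 4).const_mul 2).sub (h 5)).const_mul (Real.sqrt 2/2)).add (h 2)).sub (h 1)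
  have hf' := hf.fderiv
  refine (congrArg (fun φ => φ v) hf').trans ?_
  simp

/-- On `{L = 0}` the derivative of the barrier function along the Einstein vector field, written in
terms of `2Y₂ − Y₃` and `X₂ − X₃`. -/
theorem barrier_derivative_eq (m : ℕ) (p : Fin 6 → ℝ) (hL : L m p = 0) :
    (Real.sqrt 2/2)*(2*V m p 4 - V m p 5) + V m p 2 - V m p 1 =
      (1 - G m p - Real.sqrt 2 * p 5) * (p 1 - p 2)
      + ((Real.sqrt 2/2) * (G m p - p 1) + (m:ℝ)/2 * p 5 - (2*p 4 - p 5)/2) * (2*p 4 - p 5)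
      + (p 3)^2/8 * ((2*p 4 - p 5) * (2*p 4 + p 5)) := by
  have h1 : V m p 1 = p 1 * (G m p + L m p - 1) + R2 m p - L m p := rfl
  have h2 : V m p 2 = p 2 * (G m p + L m p - 1) + R3 m p - L m p := rfl
  have h4 : V m p 4 = p 4 * (G m p + L m p - p 1) := rfl
  have h5 : V m p 5 = p 5 * (G m p + L m p + p 1 - 2*p 2) := rfl
  rw [h1, h2, h4, h5, hL, R2, R3]
  ring

theorem G_PALC1 (m : ℕ) : G m (PALC1 m) = 1/(4*(m:ℝ)+2) := by
  have h0 : PALC1 m 0 = 0 := rfl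
  have h1 : PALC1 m 1 = 1/(4*(m:ℝ)+2) := rfl
  have h2 : PALC1 m 2 = 1/(4*(m:ℝ)+2) := rfl
  have hn : (4*(m:ℝ)+2) ≠ 0 := by positivity
  rw [G, h0, h1, h2]
  field_simp
  ring

theorem continuous_G (m : ℕ) : Continuous (G m) := by
  unfold G
  fun_prop

theorem PALC1_five_pos (m : ℕ) : 0 < PALC1 m 5 := by
  have h5 : PALC1 m 5 = (1/(2*(m:ℝ)+1)) * Real.sqrt ((4*(m:ℝ)+1)/(2*(m:ℝ)+2)) := rfl
  rw [h5]
  positivity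

theorem sqrt_two_mul_PALC1_five_lt (m : ℕ) :
    Real.sqrt 2 * PALC1 m 5 < 4/(4*(m:ℝ)+2) := by
  have h5 : PALC1 m 5 = (1/(2*(m:ℝ)+1)) * Real.sqrt ((4*(m:ℝ)+1)/(2*(m:ℝ)+2)) := rfl
  have hs : Real.sqrt ((4*(m:ℝ)+1)/(2*(m:ℝ)+2)) < Real.sqrt 2 := by
    apply Real.sqrt_lt_sqrt (by positivity)
    rw [div_lt_iff₀ (by positivity)]
    linarith
  have h2 : Real.sqrt 2 * Real.sqrt 2 = 2 := Real.mul_self_sqrt (by norm_num)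
  have h2p : 0 < Real.sqrt 2 := by positivity
  calc Real.sqrt 2 * PALC1 m 5
      = (1/(2*(m:ℝ)+1)) * (Real.sqrt 2 * Real.sqrt ((4*(m:ℝ)+1)/(2*(m:ℝ)+2))) := by
        rw [h5]; ring
    _ < (1/(2*(m:ℝ)+1)) * (Real.sqrt 2 * Real.sqrt 2) := by gcongr
    _ = 4/(4*(m:ℝ)+2) := by
        rw [h2]
        field_simp
        ring

theorem stmt11 (m : ℕ) (hm : 1 ≤ m) :
    ∃ ε > 0, ∀ p ∈ setS m ∩ bdryE m,
      dist p (PALC1 m) < ε → p 2 < p 1 →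
      0 < fderiv ℝ (fun q => (Real.sqrt 2/2)*(2*q 4 - q 5) + q 2 - q 1) p (V m p) := by
  have hmR : (1:ℝ) ≤ m := by exact_mod_cast hm
  have hG := continuous_G m
  have hA : ∀ᶠ p in nhds (PALC1 m), 0 < 1 - G m p - Real.sqrt 2 * p 5 := by
    refine Filter.Tendsto.eventually_const_lt ?_ (Continuous.tendsto (by fun_prop) _)
    have h := sqrt_two_mul_PALC1_five_lt m
    have h' : 1/(4*(m:ℝ)+2) + 4/(4*(m:ℝ)+2) ≤ 1 := by
      rw [← add_div, div_le_one (by positivity)]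
      linarith
    rw [G_PALC1]
    linarith
  have hB : ∀ᶠ p in nhds (PALC1 m),
      0 < (Real.sqrt 2/2) * (G m p - p 1) + (m:ℝ)/2 * p 5 - (2*p 4 - p 5)/2 := by
    refine Filter.Tendsto.eventually_const_lt ?_ (Continuous.tendsto (by fun_prop) _)
    have h1 : PALC1 m 1 = 1/(4*(m:ℝ)+2) := rfl
    have h45 : 2 * PALC1 m 4 - PALC1 m 5 = 0 := by
      change 2 * ((1/(4*(m:ℝ)+2)) * Real.sqrt ((4*(m:ℝ)+1)/(2*(m:ℝ)+2)))
        - (1/(2*(m:ℝ)+1)) * Real.sqrt ((4*(m:ℝ)+1)/(2*(m:ℝ)+2)) = 0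
      rw [show 4*(m:ℝ)+2 = 2*(2*(m:ℝ)+1) by ring]
      field_simp
      ring
    have h5 := PALC1_five_pos m
    have hpos : 0 < (m:ℝ)/2 * PALC1 m 5 := by positivity
    rw [G_PALC1, h1, h45]
    linarith
  obtain ⟨ε, hε, H⟩ := Metric.eventually_nhds_iff.1 (hA.and hB)
  refine ⟨ε, hε, fun p ⟨⟨⟨⟨_, hP⟩, _⟩, hA2⟩, hbd⟩ hp hlt => ?_⟩
  obtain ⟨hAp, hBp⟩ := H hp
  have hL : L m p = 0 := by
    rw [L, hbd.2]
    simp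
  rw [fderiv_barrier_apply, barrier_derivative_eq m p hL]
  have hu : 0 ≤ 2*p 4 - p 5 := hA2.1
  have hsum : 0 ≤ 2*p 4 + p 5 := by linarith [hP.2.1, hP.2.2]
  have hd : 0 < p 1 - p 2 := sub_pos.2 hlt
  positivity

end
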